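/- Let M = (M_p) be a logarithmically convex sequence of positive reals with M_0 = 1, whose quotients m_p := M_{p+1}/M_p tend to infinity, and which admits a nonzero proximate order. Let γ > 0 satisfy either γ > ω(M), or γ = ω(M) together with the divergence of the series Σ_{p≥0} (m_p)^{−1/ω(M)}. Suppose f is a bounded holomorphic function on the sector S_γ that admits a continuous extension to the boundary ∂S_γ and is M-flat in both boundary directions d = πγ/2 and −d = −πγ/2. Then f ≡ 0. -/

import Mathlib

open Filter Topology Set
open scoped Real

noncomputable section

/-!
We model functions on (subsets of) the Riemann surface of the logarithm through the
logarithmic chart: a point `z = e^w` of the Riemann surface (with modulus `|z| = exp (Re w)`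
and argument `arg z = Im w`) corresponds to the point `w : ℂ`.  A holomorphic function `f`
on a sector corresponds to the holomorphic function `w ↦ f (e^w)` on the corresponding
horizontal strip, and `z → 0` corresponds to `Re w → -∞`.
-/

/-- `M` is a sequence of positive reals with `M 0 = 1`, logarithmically convex,
whose sequence of quotients `m p = M (p+1) / M p` tends to infinity. -/
def GoodSeq (M : ℕ → ℝ) : Prop :=
  M 0 = 1 ∧ (∀ p, 0 < M p) ∧ (∀ p : ℕ, (M (p + 1)) ^ 2 ≤ M p * M (p + 2)) ∧
    Tendsto (fun p : ℕ => M (p + 1) / M p) atTop atTop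

/-- The associated function `M(t) = sup_p log (t^p / M_p)`. -/
def assocM (M : ℕ → ℝ) (t : ℝ) : ℝ := ⨆ p : ℕ, Real.log (t ^ p / M p)

/-- The index `ω(M) = liminf_p log (m_p) / log p`. -/
def omegaM (M : ℕ → ℝ) : ℝ :=
  Filter.liminf (fun p : ℕ => Real.log (M (p + 1) / M p) / Real.log (p : ℝ)) atTop

/-- `ρ` is a proximate order on `(c, ∞)` with limit `ℓ` at infinity:  continuous and
piecewise continuously differentiable (differentiable except possibly on a set `E` of points
that is finite below any bound, at each of which it has distinct finite lateral derivatives),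
nonnegative, with `ρ(r) → ℓ` and `r ρ'(r) log r → 0` as `r → ∞`. -/
def IsProximateOrder (c : ℝ) (ρ : ℝ → ℝ) (ℓ : ℝ) : Prop :=
  ContinuousOn ρ (Ioi c) ∧ (∀ r ∈ Ioi c, 0 ≤ ρ r) ∧ Tendsto ρ atTop (𝓝 ℓ) ∧
    ∃ (E : Set ℝ) (ρ' : ℝ → ℝ),
      (∀ R : ℝ, (E ∩ Iic R).Finite) ∧
      (∀ r ∈ Ioi c \ E, HasDerivAt ρ (ρ' r) r) ∧
      ContinuousOn ρ' (Ioi c \ E) ∧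
      (∀ r ∈ E ∩ Ioi c, ∃ dl dr : ℝ, dl ≠ dr ∧
        HasDerivWithinAt ρ dl (Iio r) r ∧ HasDerivWithinAt ρ dr (Ioi r) r) ∧
      Tendsto (fun r => r * ρ' r * Real.log r) (atTop ⊓ 𝓟 (Ioi c \ E)) (𝓝 0)

/-- The sequence `M` admits a nonzero proximate order: there are a nonzero proximate order
`ρ(t)` and constants `A ≤ B` with `A ≤ log t · (ρ(t) − d_M(t)) ≤ B` for `t` large,
where `d_M(t) = log M(t) / log t`. -/
def AdmitsNonzeroProximateOrder (M : ℕ → ℝ) : Prop :=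
  ∃ (c ℓ : ℝ) (ρ : ℝ → ℝ), 0 < ℓ ∧ IsProximateOrder c ρ ℓ ∧
    ∃ A B : ℝ, ∀ᶠ t in atTop,
      A ≤ Real.log t * (ρ t - Real.log (assocM M t) / Real.log t) ∧
      Real.log t * (ρ t - Real.log (assocM M t) / Real.log t) ≤ B

/-- The unbounded open sector `S(d, γ)` (bisecting direction `d`, opening `γπ`),
in the logarithmic chart. -/
def logSector (d γ : ℝ) : Set ℂ := {w : ℂ | |w.im - d| < γ * π / 2}

/-- The bounded open sector `S(d, γ, R)` (radius `R`), in the logarithmic chart. -/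
def logSectorB (d γ R : ℝ) : Set ℂ :=
  {w : ℂ | |w.im - d| < γ * π / 2 ∧ w.re < Real.log R}

/-- The closure of `S(d, γ, R)` in the Riemann surface of the logarithm
(the vertex is not present), in the logarithmic chart. -/
def logSectorC (d γ R : ℝ) : Set ℂ :=
  {w : ℂ | |w.im - d| ≤ γ * π / 2 ∧ w.re ≤ Real.log R}

/-- `G` is a sectorial region `G(d, γ)`: an open connected subset of `S(d, γ)` that,
for every `0 < β < γ`, contains a bounded sector `S(d, β, ρ)`. -/
def SectorialRegion (d γ : ℝ) (G : Set ℂ) : Prop :=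
  IsOpen G ∧ IsConnected G ∧ G ⊆ logSector d γ ∧
    ∀ β : ℝ, 0 < β → β < γ → ∃ ρ : ℝ, 0 < ρ ∧ logSectorB d β ρ ⊆ G

/-- The bounded sector `S(d, β, r)` is a proper subsector of `G` (written `T ≪ G`):
its closure in the Riemann surface of the logarithm is contained in `G`. -/
def ProperSubsector (G : Set ℂ) (d β r : ℝ) : Prop :=
  0 < β ∧ 0 < r ∧ logSectorC d β r ⊆ G

/-- `f` (defined on `D`) is `M`-flat in the direction `θ`: there are `r, C, A > 0` such that
the segment `(0, r e^{iθ}]` lies in `D` and `|f(z)| ≤ C A^p M_p |z|^p` on it, for all `p`. -/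
def MFlatDir (M : ℕ → ℝ) (f : ℂ → ℂ) (D : Set ℂ) (θ : ℝ) : Prop :=
  ∃ r C A : ℝ, 0 < r ∧ 0 < C ∧ 0 < A ∧
    (∀ x : ℝ, x ≤ Real.log r → (⟨x, θ⟩ : ℂ) ∈ D) ∧
    ∀ x : ℝ, x ≤ Real.log r → ∀ p : ℕ,
      ‖f ⟨x, θ⟩‖ ≤ C * A ^ p * M p * Real.exp x ^ p

/-- `f` (bounded, defined on `D`) is Beurling `M`-flat in the direction `θ`. -/
def BeurlingFlatDir (M : ℕ → ℝ) (f : ℂ → ℂ) (D : Set ℂ) (θ : ℝ) : Prop :=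
  ∀ c2 : ℝ, 0 < c2 → ∃ c1 : ℝ, 0 < c1 ∧
    ∀ w ∈ D, w.im = θ →
      ‖f w‖ ≤ c1 * Real.exp (-assocM M (1 / (c2 * Real.exp w.re)))

/-- `f` admits `Σ a_n z^n` as its `M`-asymptotic expansion in the region `G`:  on every
proper subsector `T ≪ G` there are `C, A > 0` with
`|f(z) − Σ_{n<p} a_n z^n| ≤ C A^p M_p |z|^p` for all `z ∈ T`, `p ∈ ℕ`.
(In the logarithmic chart, `z = e^w`.) -/
def AsympExpandsOn (M : ℕ → ℝ) (f : ℂ → ℂ) (a : ℕ → ℂ) (G : Set ℂ) : Prop :=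
  ∀ d β r : ℝ, ProperSubsector G d β r → ∃ C A : ℝ, 0 < C ∧ 0 < A ∧
    ∀ w ∈ logSectorB d β r, ∀ p : ℕ,
      ‖f w - ∑ n ∈ Finset.range p, a n * Complex.exp w ^ n‖
        ≤ C * A ^ p * M p * Real.exp w.re ^ p

/-- `f` admits `Σ a_n z^n` as its `M`-asymptotic expansion in the direction `θ`: there are
`r, C, A > 0` such that the segment `(0, r e^{iθ}]` lies in `G` and
`|f(z) − Σ_{n<p} a_n z^n| ≤ C A^p M_p |z|^p` on it, for all `p`. -/
def AsympExpandsDir (M : ℕ → ℝ) (f : ℂ → ℂ) (a : ℕ → ℂ) (G : Set ℂ) (θ : ℝ) : Prop :=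
  ∃ r C A : ℝ, 0 < r ∧ 0 < C ∧ 0 < A ∧
    (∀ x : ℝ, x ≤ Real.log r → (⟨x, θ⟩ : ℂ) ∈ G) ∧
    ∀ x : ℝ, x ≤ Real.log r → ∀ p : ℕ,
      ‖f (⟨x, θ⟩ : ℂ) - ∑ n ∈ Finset.range p, a n * Complex.exp (⟨x, θ⟩ : ℂ) ^ n‖
        ≤ C * A ^ p * M p * Real.exp x ^ p

/-- The derivative with respect to the base variable `z = e^w`, in the logarithmic chart:
`(d/dz) f = e^{-w} (d/dw) f`. -/
def zderiv (f : ℂ → ℂ) : ℂ → ℂ := fun w => Complex.exp (-w) * deriv f w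

/-- The filter of approach to the vertex (`z → 0`, i.e. `Re w → -∞`) within `D`. -/
def vertexFilter (D : Set ℂ) : Filter ℂ := Filter.comap Complex.re atBot ⊓ 𝓟 D

/-- The class `Ã^u_M(S)` contains no nontrivial function whose uniform `M`-asymptotic
expansion on `S` is the null power series. -/
def UniformQuasianalytic (M : ℕ → ℝ) (S : Set ℂ) : Prop :=
  ∀ f : ℂ → ℂ, DifferentiableOn ℂ f S →
    (∃ C A : ℝ, 0 < C ∧ 0 < A ∧
      ∀ w ∈ S, ∀ p : ℕ, ‖f w‖ ≤ C * A ^ p * M p * Real.exp w.re ^ p) →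
    ∀ w ∈ S, f w = 0

/-- The outer multiplier `ζ + √(ζ² + 1)` on the right half-plane. -/
def wq (ζ : ℂ) : ℂ := ζ + (ζ + Complex.I) ^ (1 / 2 : ℂ) * (ζ - Complex.I) ^ (1 / 2 : ℂ)

lemma half_sq (z : ℂ) : (z ^ (1 / 2 : ℂ)) ^ 2 = z := by
  have := Complex.cpow_nat_inv_pow z (n := 2) two_ne_zero
  simpa only [one_div, Nat.cast_ofNat] using this

lemma wq_s_sq (ζ : ℂ) :
    ((ζ + Complex.I) ^ (1 / 2 : ℂ) * (ζ - Complex.I) ^ (1 / 2 : ℂ)) ^ 2 = ζ ^ 2 + 1 := by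
  rw [mul_pow, half_sq, half_sq]
  have := Complex.I_sq
  linear_combination -this

lemma wq_norm_le (ζ : ℂ) : ‖wq ζ‖ ≤ 2 * ‖ζ‖ + 1 := by
  unfold wq
  have h := congrArg norm (wq_s_sq ζ)
  set s := (ζ + Complex.I) ^ (1 / 2 : ℂ) * (ζ - Complex.I) ^ (1 / 2 : ℂ)
  rw [norm_pow] at h
  have h1 : ‖ζ ^ 2 + 1‖ ≤ ‖ζ‖ ^ 2 + 1 := by
    refine (norm_add_le _ _).trans ?_
    simp
  have h2 : ‖s‖ ≤ ‖ζ‖ + 1 := by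
    by_contra hc
    push Not at hc
    nlinarith [norm_nonneg ζ, norm_nonneg s]
  linarith [norm_add_le ζ s]

lemma wq_bdry (σ : ℝ) : ‖wq (σ * Complex.I)‖ ≤ max 1 (2 * |σ|) := by
  unfold wq
  have h := wq_s_sq (σ * Complex.I)
  set s := ((σ : ℂ) * Complex.I + Complex.I) ^ (1 / 2 : ℂ) * (σ * Complex.I - Complex.I) ^ (1 / 2 : ℂ)
  have hre := congrArg Complex.re h
  have him := congrArg Complex.im h
  simp [pow_two] at hre him
  have hn : ‖(σ : ℂ) * Complex.I + s‖ ^ 2 = s.re ^ 2 + (σ + s.im) ^ 2 := by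
    rw [← Complex.normSq_eq_norm_sq, Complex.normSq_apply]
    simp; ring
  by_cases hσ : |σ| ≤ 1
  · apply le_max_of_le_left
    have hσ2 : σ ^ 2 ≤ 1 := by nlinarith [sq_abs σ, abs_nonneg σ]
    have hsim : s.im = 0 := by
      have : s.re * s.im = 0 := by linarith
      rcases mul_eq_zero.1 this with h0 | h0
      · rw [h0] at hre
        nlinarith
      · exact h0
    rw [hsim] at hn hre
    have : ‖(σ : ℂ) * Complex.I + s‖ ^ 2 ≤ 1 := by rw [hn]; nlinarith
    nlinarith [norm_nonneg ((σ : ℂ) * Complex.I + s)]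
  · apply le_max_of_le_right
    push Not at hσ
    have hσ2 : 1 < σ ^ 2 := by nlinarith [sq_abs σ, abs_nonneg σ]
    have hsre : s.re = 0 := by
      have : s.re * s.im = 0 := by linarith
      rcases mul_eq_zero.1 this with h0 | h0
      · exact h0
      · rw [h0] at hre
        nlinarith
    rw [hsre] at hn hre
    have h3 : ‖(σ : ℂ) * Complex.I + s‖ ^ 2 ≤ (2 * |σ|) ^ 2 := by
      rw [hn, mul_pow, sq_abs]; nlinarith [sq_nonneg (σ - s.im)]
    exact abs_le_of_sq_le_sq' h3 (by positivity) |>.2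

lemma wq_real (x : ℝ) (hx : 0 < x) : 1 + x ≤ ‖wq x‖ := by
  have hc : ((x : ℂ) - Complex.I) ^ (1 / 2 : ℂ)
      = (starRingEnd ℂ) (((x : ℂ) + Complex.I) ^ (1 / 2 : ℂ)) := by
    have harg : ((x : ℂ) + Complex.I).arg ≠ π := by
      intro h
      rw [Complex.arg_eq_pi_iff] at h
      simp at h
    have := Complex.cpow_conj ((x : ℂ) + Complex.I) (1 / 2) harg
    simp only [map_add, Complex.conj_ofReal, Complex.conj_I] at this
    rw [← sub_eq_add_neg] at this
    have h2 : (starRingEnd ℂ) (1 / 2 : ℂ) = 1 / 2 := by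
      rw [map_div₀, map_one, Complex.conj_ofNat]
    rw [h2] at this
    rw [this, Complex.conj_conj]
  have hsq := wq_s_sq x
  unfold wq
  rw [hc, Complex.mul_conj] at *
  set N := Complex.normSq (((x : ℂ) + Complex.I) ^ (1 / 2 : ℂ))
  have hN : 0 ≤ N := Complex.normSq_nonneg _
  have hN2 : N ^ 2 = x ^ 2 + 1 := by exact_mod_cast hsq
  rw [← Complex.ofReal_add, Complex.norm_real, Real.norm_of_nonneg (by linarith)]
  nlinarith

lemma wq_diff (ζ : ℂ) (h : 0 < ζ.re) : DifferentiableAt ℂ wq ζ := by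
  unfold wq
  have h1 : ζ + Complex.I ∈ Complex.slitPlane := Or.inl (by simpa using h)
  have h2 : ζ - Complex.I ∈ Complex.slitPlane := Or.inl (by simpa using h)
  refine differentiableAt_id.add (DifferentiableAt.mul ?_ ?_)
  · exact (differentiableAt_id.add_const _).cpow_const h1
  · exact (differentiableAt_id.sub_const _).cpow_const h2

lemma wq_cont (ζ : ℂ) (h : 0 ≤ ζ.re) : ContinuousAt wq ζ := by
  unfold wq
  refine continuousAt_id.add (ContinuousAt.mul ?_ ?_)
  · exact ContinuousAt.comp (g := fun x : ℂ => x ^ (1 / 2 : ℂ)) (f := fun ζ : ℂ => ζ + Complex.I)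
      (Complex.continuousAt_cpow_const_of_re_pos (Or.inl (by simpa using h)) (by norm_num))
      (by fun_prop)
  · exact ContinuousAt.comp (g := fun x : ℂ => x ^ (1 / 2 : ℂ)) (f := fun ζ : ℂ => ζ - Complex.I)
      (Complex.continuousAt_cpow_const_of_re_pos (Or.inl (by simpa using h)) (by norm_num))
      (by fun_prop)

/-- The quotients are positive. -/
lemma quot_pos {M : ℕ → ℝ} (hM : GoodSeq M) (p : ℕ) : 0 < M (p + 1) / M p :=
  div_pos (hM.2.1 _) (hM.2.1 _)

lemma quot_mono {M : ℕ → ℝ} (hM : GoodSeq M) : Monotone (fun p => M (p + 1) / M p) := by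
  refine monotone_nat_of_le_succ fun p => ?_
  rw [div_le_div_iff₀ (hM.2.1 _) (hM.2.1 _)]
  have := hM.2.2.1 p
  rw [show p + 1 + 1 = p + 2 from rfl]
  nlinarith

lemma seq_eq_prod {M : ℕ → ℝ} (hM : GoodSeq M) (n : ℕ) :
    M n = ∏ i ∈ Finset.range n, (M (i + 1) / M i) := by
  induction n with
  | zero => simp [hM.1]
  | succ n ih =>
    rw [Finset.prod_range_succ, ← ih]
    field_simp [(hM.2.1 n).ne']

lemma exists_prod_min (u : ℕ → ℝ) (hu : Monotone u) (N : ℕ) :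
    ∃ j, ∏ i ∈ Finset.range N, min 1 (u i) = ∏ i ∈ Finset.range j, u i := by
  induction N with
  | zero => exact ⟨0, by simp⟩
  | succ N ih =>
    by_cases h : u N ≤ 1
    · refine ⟨N + 1, Finset.prod_congr rfl fun i hi => min_eq_right ?_⟩
      exact (hu (by simpa [Nat.lt_succ_iff] using hi)).trans h
    · obtain ⟨j, hj⟩ := ih
      refine ⟨j, ?_⟩
      rw [Finset.prod_range_succ, hj, min_eq_left (not_le.1 h).le, mul_one]

lemma one_add_sum_le_prod' (a : ℕ → ℝ) (ha : ∀ i, 0 ≤ a i) (n : ℕ) :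
    1 + ∑ i ∈ Finset.range n, a i ≤ ∏ i ∈ Finset.range n, (1 + a i) := by
  induction n with
  | zero => simp
  | succ n ih =>
    rw [Finset.sum_range_succ, Finset.prod_range_succ]
    have h1 : 0 ≤ ∑ i ∈ Finset.range n, a i := Finset.sum_nonneg fun i _ => ha i
    nlinarith [ha n]

/-- At `t = m_p` the supremum defining `M(t)` is attained at `p`. -/
lemma term_le {M : ℕ → ℝ} (hM : GoodSeq M) (p q : ℕ) :
    (M (p + 1) / M p) ^ q / M q ≤ (M (p + 1) / M p) ^ p / M p := by
  set t := M (p + 1) / M p with ht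
  have htp : 0 < t := quot_pos hM p
  have key : ∀ i, t ^ (i + 1) / M (i + 1) = t ^ i / M i * (t / (M (i + 1) / M i)) := by
    intro i
    have := (hM.2.1 i).ne'
    have := (hM.2.1 (i + 1)).ne'
    field_simp
    ring
  have hpos : ∀ i, 0 < t ^ i / M i := fun i => div_pos (pow_pos htp _) (hM.2.1 _)
  rcases le_total q p with h | h
  · have : ∀ n, q ≤ n → n ≤ p → t ^ q / M q ≤ t ^ n / M n := by
      intro n hn
      induction n, hn using Nat.le_induction with
      | base => exact fun _ => le_rfl
      | succ n hn ih =>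
        intro hnp
        refine (ih (by omega)).trans ?_
        rw [key n]
        refine le_mul_of_one_le_right (hpos n).le ?_
        rw [one_le_div (quot_pos hM n)]
        exact quot_mono hM (by omega)
    exact this p h le_rfl
  · induction q, h using Nat.le_induction with
    | base => exact le_rfl
    | succ n hn ih =>
      refine le_trans ?_ ih
      rw [key n]
      refine mul_le_of_le_one_right (hpos n).le ?_
      rw [div_le_one (quot_pos hM n)]
      exact quot_mono hM hn

lemma log_assoc_le {M : ℕ → ℝ} (hM : GoodSeq M) (p : ℕ) :
    assocM M (M (p + 1) / M p) ≤
      p * (Real.log (M (p + 1) / M p) - Real.log (M 1 / M 0)) := by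
  unfold assocM
  have ht := quot_pos hM p
  refine ciSup_le fun q => ?_
  have hMp : (M 1 / M 0) ^ p ≤ M p := by
    rw [seq_eq_prod hM p]
    have hc : ∏ _i ∈ Finset.range p, (M 1 / M 0) = (M 1 / M 0) ^ p := by
      rw [Finset.prod_const, Finset.card_range]
    rw [← hc]
    exact Finset.prod_le_prod (fun _ _ => (quot_pos hM 0).le)
      (fun i _ => quot_mono hM (Nat.zero_le i))
  have h0 := quot_pos hM 0
  calc Real.log ((M (p + 1) / M p) ^ q / M q)
      ≤ Real.log ((M (p + 1) / M p) ^ p / M p) :=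
        Real.log_le_log (div_pos (pow_pos ht _) (hM.2.1 _)) (term_le hM p q)
    _ ≤ Real.log ((M (p + 1) / M p) ^ p / (M 1 / M 0) ^ p) := by
        refine Real.log_le_log (div_pos (pow_pos ht _) (hM.2.1 _)) ?_
        exact div_le_div_of_nonneg_left (pow_pos ht _).le (pow_pos h0 _) hMp
    _ = _ := by
        rw [Real.log_div (pow_pos ht _).ne' (pow_pos h0 _).ne', Real.log_pow, Real.log_pow]
        ring

lemma assoc_nonneg {M : ℕ → ℝ} (hM : GoodSeq M) (t : ℝ) : 0 ≤ assocM M t :=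
  Real.iSup_nonneg' ⟨0, by simp [hM.1]⟩

lemma cobdd {M : ℕ → ℝ} (hM : GoodSeq M) (hPO : AdmitsNonzeroProximateOrder M) :
    IsCoboundedUnder (· ≥ ·) atTop
      (fun p : ℕ => Real.log (M (p + 1) / M p) / Real.log (p : ℝ)) := by
  obtain ⟨c, ℓ, ρ, hℓ, hρ, A, B, hAB⟩ := hPO
  have hlim := hρ.2.2.1
  refine IsCoboundedUnder.of_frequently_le (a := 8 / ℓ) ?_
  intro hcon
  have hm := hM.2.2.2
  have h1 := hm.eventually hAB
  have h2 := hm.eventually (hlim.eventually (lt_mem_nhds (show ℓ / 2 < ℓ by linarith)))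
  have hT : Tendsto (fun p : ℕ => Real.log (M (p + 1) / M p)) atTop atTop :=
    Real.tendsto_log_atTop.comp hm
  have hlo : ∀ᶠ T : ℝ in atTop, Real.log T ≤ ℓ / 8 * T := by
    have := Real.isLittleO_log_id_atTop.bound (show 0 < ℓ / 8 by positivity)
    filter_upwards [this, eventually_gt_atTop 1] with T h h1
    rw [Real.norm_of_nonneg (Real.log_nonneg h1.le), id, Real.norm_of_nonneg (by linarith)] at h
    exact h
  have h3 := hT.eventually hlo
  have h4 := hT.eventually_gt_atTop 1
  have h5 := hT.eventually_gt_atTop (-Real.log (M 1 / M 0))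
  have h6 := hT.eventually_gt_atTop ((|B| + Real.log 2) * (4 / ℓ))
  obtain ⟨p, hc, hp1, hp2, hp3, hp4, hp5, hp6, hp2'⟩ :=
    (hcon.and (h1.and (h2.and (h3.and (h4.and (h5.and
      (h6.and (eventually_ge_atTop 2)))))))).exists
  have hap := log_assoc_le hM p
  have han := assoc_nonneg hM (M (p + 1) / M p)
  set T := Real.log (M (p + 1) / M p)
  have hlogp : 0 < Real.log (p : ℝ) := Real.log_pos (by exact_mod_cast hp2')
  have hpT : Real.log p < T * (ℓ / 8) := by
    rw [not_le, lt_div_iff₀ hlogp] at hc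
    have : 8 / ℓ * Real.log p * (ℓ / 8) = Real.log p := by field_simp
    nlinarith
  have hup : Real.log (assocM M (M (p + 1) / M p)) ≤ Real.log p + (Real.log 2 + Real.log T) := by
    have hp0 : (0 : ℝ) < p := by positivity
    rcases han.eq_or_lt with h0 | h0
    · rw [← h0, Real.log_zero]
      have := Real.log_nonneg hp4.le
      have := Real.log_nonneg (show (1 : ℝ) ≤ 2 by norm_num)
      linarith
    · rw [← Real.log_mul (by norm_num) (by linarith), ← Real.log_mul hp0.ne' (by linarith)]
      refine Real.log_le_log h0 (hap.trans ?_)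
      exact mul_le_mul_of_nonneg_left (by linarith) hp0.le
  have hlow := hp1.2
  have : T * (ρ (M (p + 1) / M p) - Real.log (assocM M (M (p + 1) / M p)) / T)
      = T * ρ (M (p + 1) / M p) - Real.log (assocM M (M (p + 1) / M p)) := by
    field_simp
  rw [this] at hlow
  have h7 : T * (ℓ / 2) ≤ T * ρ (M (p + 1) / M p) :=
    mul_le_mul_of_nonneg_left hp2.le (by linarith)
  have h8 : |B| + Real.log 2 < T * (ℓ / 4) := by
    have : (|B| + Real.log 2) * (4 / ℓ) * (ℓ / 4) = |B| + Real.log 2 := by field_simp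
    nlinarith
  linarith [le_abs_self B]

lemma not_summable_of {M : ℕ → ℝ} (hM : GoodSeq M) (hPO : AdmitsNonzeroProximateOrder M)
    {γ : ℝ} (hγ : 0 < γ) (h : omegaM M < γ) :
    ¬ Summable (fun p : ℕ => (M (p + 1) / M p) ^ (-(1 / γ))) := by
  intro hs
  obtain ⟨δ, hδ1, hδ2⟩ := exists_between h
  have hfr := frequently_lt_of_liminf_lt (cobdd hM hPO) hδ1
  have hpow : Tendsto (fun p : ℕ => (p : ℝ) ^ (1 - δ / γ)) atTop atTop :=
    (tendsto_rpow_atTop (by rw [sub_pos, div_lt_one hγ]; exact hδ2)).comp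
      tendsto_natCast_atTop_atTop
  obtain ⟨p, hp1, hp2, hp3⟩ := (hfr.and_eventually ((hpow.eventually_gt_atTop
    (∑' p : ℕ, (M (p + 1) / M p) ^ (-(1 / γ)))).and (eventually_ge_atTop 2))).exists
  have hlogp : 0 < Real.log (p : ℝ) := Real.log_pos (by exact_mod_cast hp3)
  have hp0 : (0 : ℝ) < p := by positivity
  rw [div_lt_iff₀ hlogp] at hp1
  have hm := quot_pos hM p
  have hlt : (p : ℝ) ^ (-(δ / γ)) ≤ (M (p + 1) / M p) ^ (-(1 / γ)) := by
    rw [Real.rpow_def_of_pos hp0, Real.rpow_def_of_pos hm]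
    apply Real.exp_le_exp.2
    have : 0 < 1 / γ := by positivity
    have h2 : δ / γ = δ * (1 / γ) := by ring
    rw [h2]
    nlinarith
  have hsum : ∑ i ∈ Finset.range p, (M (p + 1) / M p) ^ (-(1 / γ)) ≤
      ∑ i ∈ Finset.range p, (M (i + 1) / M i) ^ (-(1 / γ)) := by
    refine Finset.sum_le_sum fun i hi => ?_
    refine Real.rpow_le_rpow_of_nonpos (quot_pos hM i) ?_ ?_
    · exact quot_mono hM (Finset.mem_range.1 hi).le
    · rw [neg_nonpos]; positivity
  have hts := hs.sum_le_tsum (Finset.range p)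
    (fun i _ => Real.rpow_nonneg (quot_pos hM i).le _)
  rw [Finset.sum_const, Finset.card_range, nsmul_eq_mul] at hsum
  have : (p : ℝ) ^ (1 - δ / γ) = p * (p : ℝ) ^ (-(δ / γ)) := by
    rw [sub_eq_add_neg, Real.rpow_add hp0, Real.rpow_one]
  rw [this] at hp2
  nlinarith

/-- The factor of the multiplier in the logarithmic chart. -/
def wfac (γ v : ℝ) (w : ℂ) : ℂ :=
  wq (Complex.exp (-w / γ) / ((2 * v ^ (1 / γ) : ℝ) : ℂ))

lemma wexp_re (γ : ℝ) (w : ℂ) :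
    (Complex.exp (-w / γ)).re = Real.exp (-w.re / γ) * Real.cos (w.im / γ) := by
  rw [Complex.exp_re]
  have h1 : (-w / (γ : ℂ)).re = -w.re / γ := by simp [Complex.div_ofReal_re]
  have h2 : (-w / (γ : ℂ)).im = -(w.im / γ) := by
    simp [Complex.div_ofReal_im, neg_div]
  rw [h1, h2, Real.cos_neg]

lemma wexp_norm (γ : ℝ) (w : ℂ) :
    ‖Complex.exp (-w / γ)‖ = Real.exp (-w.re / γ) := by
  rw [Complex.norm_exp]
  have h1 : (-w / (γ : ℂ)).re = -w.re / γ := by simp [Complex.div_ofReal_re]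
  rw [h1]

lemma warg_re_nonneg {γ v : ℝ} (hγ : 0 < γ) (hv : 0 < v) {w : ℂ} (hw : |w.im| ≤ γ * π / 2) :
    0 ≤ (Complex.exp (-w / γ) / ((2 * v ^ (1 / γ) : ℝ) : ℂ)).re := by
  rw [Complex.div_ofReal_re, wexp_re]
  have hb : 0 < v ^ (1 / γ) := Real.rpow_pos_of_pos hv _
  have : 0 ≤ Real.cos (w.im / γ) := by
    rw [abs_le] at hw
    apply Real.cos_nonneg_of_neg_pi_div_two_le_of_le
    · rw [le_div_iff₀ hγ]; linarith
    · rw [div_le_iff₀ hγ]; linarith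
  positivity

lemma warg_re_pos {γ v : ℝ} (hγ : 0 < γ) (hv : 0 < v) {w : ℂ} (hw : |w.im| < γ * π / 2) :
    0 < (Complex.exp (-w / γ) / ((2 * v ^ (1 / γ) : ℝ) : ℂ)).re := by
  rw [Complex.div_ofReal_re, wexp_re]
  have hb : 0 < v ^ (1 / γ) := Real.rpow_pos_of_pos hv _
  have : 0 < Real.cos (w.im / γ) := by
    rw [abs_lt] at hw
    apply Real.cos_pos_of_mem_Ioo
    constructor
    · rw [lt_div_iff₀ hγ]; linarith
    · rw [div_lt_iff₀ hγ]; linarith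
  positivity

lemma wfac_cont {γ v : ℝ} (hγ : 0 < γ) (hv : 0 < v) {w : ℂ} (hw : |w.im| ≤ γ * π / 2) :
    ContinuousAt (wfac γ v) w := by
  unfold wfac
  exact ContinuousAt.comp (g := wq)
    (f := fun w : ℂ => Complex.exp (-w / γ) / ((2 * v ^ (1 / γ) : ℝ) : ℂ))
    (wq_cont _ (warg_re_nonneg hγ hv hw)) (by fun_prop)

lemma wfac_diff {γ v : ℝ} (hγ : 0 < γ) (hv : 0 < v) {w : ℂ} (hw : |w.im| < γ * π / 2) :
    DifferentiableAt ℂ (wfac γ v) w := by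
  unfold wfac
  exact DifferentiableAt.comp (g := wq)
    (f := fun w : ℂ => Complex.exp (-w / γ) / ((2 * v ^ (1 / γ) : ℝ) : ℂ)) w
    (wq_diff _ (warg_re_pos hγ hv hw)) (by fun_prop)

lemma wfac_growth {γ v : ℝ} (hγ : 0 < γ) (hv : 0 < v) (w : ℂ) :
    ‖wfac γ v w‖ ≤ (1 / v ^ (1 / γ) + 1) * Real.exp (|w.re| / γ) := by
  unfold wfac
  have hb : 0 < v ^ (1 / γ) := Real.rpow_pos_of_pos hv _
  refine (wq_norm_le _).trans ?_
  rw [norm_div, wexp_norm, Complex.norm_real, Real.norm_of_nonneg (by positivity)]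
  have h1 : Real.exp (-w.re / γ) ≤ Real.exp (|w.re| / γ) := by
    apply Real.exp_le_exp.2
    gcongr
    exact neg_le_abs _
  have h2 : 1 ≤ Real.exp (|w.re| / γ) := Real.one_le_exp (by positivity)
  calc 2 * (Real.exp (-w.re / γ) / (2 * v ^ (1 / γ))) + 1
      = 1 / v ^ (1 / γ) * Real.exp (-w.re / γ) + 1 := by field_simp
    _ ≤ 1 / v ^ (1 / γ) * Real.exp (|w.re| / γ) + Real.exp (|w.re| / γ) := by gcongr
    _ = _ := by ring

lemma wfac_real {γ v : ℝ} (hv : 0 < v) (x : ℝ) :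
    1 + Real.exp (-x / γ) / 2 * v ^ (-(1 / γ)) ≤ ‖wfac γ v x‖ := by
  unfold wfac
  have hb : 0 < v ^ (1 / γ) := Real.rpow_pos_of_pos hv _
  have : Complex.exp (-(x : ℂ) / γ) / ((2 * v ^ (1 / γ) : ℝ) : ℂ)
      = ((Real.exp (-x / γ) / (2 * v ^ (1 / γ)) : ℝ) : ℂ) := by
    push_cast; rfl
  rw [this]
  refine le_trans (le_of_eq ?_) (wq_real _ (by positivity))
  rw [Real.rpow_neg hv.le]
  field_simp

lemma wfac_bdry {γ v : ℝ} (hγ : 0 < γ) (hv : 0 < v) {w : ℂ} (hw : |w.im| = γ * π / 2) :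
    ‖wfac γ v w‖ ≤ max 1 ((v * Real.exp w.re) ^ (-(1 / γ))) := by
  have hb : 0 < v ^ (1 / γ) := Real.rpow_pos_of_pos hv _
  have hre : (Complex.exp (-w / γ)).re = 0 := by
    rw [wexp_re, ← Real.cos_abs, abs_div, hw, abs_of_pos hγ]
    rw [show γ * π / 2 / γ = π / 2 by field_simp, Real.cos_pi_div_two, mul_zero]
  have hn := wexp_norm γ w
  set e := Complex.exp (-w / γ) with he
  have he2 : e = (e.im : ℂ) * Complex.I := by
    apply Complex.ext <;> simp [hre]
  have him : |e.im| = Real.exp (-w.re / γ) := by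
    rw [← hn]
    conv_rhs => rw [he2]
    simp
  unfold wfac
  rw [← he]
  have h3 : e / ((2 * v ^ (1 / γ) : ℝ) : ℂ)
      = ((e.im / (2 * v ^ (1 / γ)) : ℝ) : ℂ) * Complex.I := by
    conv_lhs => rw [he2]
    push_cast; ring
  rw [h3]
  refine (wq_bdry _).trans (le_of_eq ?_)
  congr 1
  rw [abs_div, him, abs_of_pos (show 0 < 2 * v ^ (1 / γ) by positivity),
    Real.mul_rpow hv.le (Real.exp_pos _).le, Real.rpow_neg hv.le, ← Real.exp_mul]
  rw [show w.re * -(1 / γ) = -w.re / γ by ring]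
  field_simp

lemma min_pow_mul {u γ B : ℝ} {k : ℕ} (hγ0 : 0 < γ) (hu : 0 < u) (hk : 1 / γ ≤ k)
    (hB : B ≤ max 1 (u ^ (-(1 / γ)))) : (min 1 u) ^ k * B ≤ 1 := by
  have hγ : 0 < 1 / γ := by positivity
  rcases le_total 1 u with h | h
  · have : u ^ (-(1 / γ)) ≤ 1 := Real.rpow_le_one_of_one_le_of_nonpos h (by linarith)
    rw [max_eq_left this] at hB
    rw [min_eq_left h]; simpa using hB
  · rw [min_eq_right h]
    have h1 : 1 ≤ u ^ (-(1 / γ)) := Real.one_le_rpow_of_pos_of_le_one_of_nonpos hu h (by linarith)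
    rw [max_eq_right h1] at hB
    calc u ^ k * B ≤ u ^ k * u ^ (-(1 / γ)) := by gcongr
      _ = u ^ ((k : ℝ) + -(1 / γ)) := by rw [Real.rpow_add hu, Real.rpow_natCast]
      _ ≤ 1 := Real.rpow_le_one hu.le h (by linarith)

lemma watson_core {M : ℕ → ℝ} (hM : GoodSeq M) {γ : ℝ} (hγ : 0 < γ)
    (hns : ¬ Summable (fun p : ℕ => (M (p + 1) / M p) ^ (-(1 / γ))))
    (g : ℂ → ℂ) (hd : DiffContOnCl ℂ g (Complex.im ⁻¹' Ioo (-(γ * π / 2)) (γ * π / 2)))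
    {K : ℝ} (hK : ∀ w : ℂ, |w.im| ≤ γ * π / 2 → ‖g w‖ ≤ K)
    {C A X : ℝ} (hA : 0 < A)
    (hflat : ∀ w : ℂ, |w.im| = γ * π / 2 → w.re ≤ X → ∀ p : ℕ,
      ‖g w‖ ≤ C * A ^ p * M p * Real.exp w.re ^ p) (x : ℝ) : g x = 0 := by
  have hh : 0 < γ * π / 2 := by positivity
  set h := γ * π / 2 with hh_def
  set m : ℕ → ℝ := fun p => M (p + 1) / M p with hm_def
  have hmpos : ∀ p, 0 < m p := quot_pos hM
  obtain ⟨k, hk⟩ := exists_nat_ge (1 / γ)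
  have hk0 : k ≠ 0 := by
    rintro rfl
    have : 0 < 1 / γ := by positivity
    simp at hk; simp at this; linarith
  -- the index from which the factors are harmless for `Re w > X`
  obtain ⟨p0, hp0⟩ := (hM.2.2.2.eventually_ge_atTop (1 / (A * Real.exp X))).exists
  have hp0' : ∀ i, 1 ≤ A * m (p0 + i) * Real.exp X := by
    intro i
    have h1 : 1 / (A * Real.exp X) ≤ m (p0 + i) := hp0.trans (quot_mono hM (by omega))
    rw [div_le_iff₀ (by positivity)] at h1
    linarith
  set L := max C K with hL
  have hvpos : ∀ i, 0 < A * m (p0 + i) := fun i => mul_pos hA (hmpos _)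
  have hC0 : ∀ w : ℂ, |w.im| = h → w.re ≤ X → ∀ n, ‖g w‖ ≤
      C * ∏ i ∈ Finset.range n, min 1 (A * m (p0 + i) * Real.exp w.re) := by
    intro w hw hwX n
    set u : ℕ → ℝ := fun i => A * m i * Real.exp w.re with hu
    have hupos : ∀ i, 0 < u i := fun i => mul_pos (mul_pos hA (hmpos _)) (Real.exp_pos _)
    have humono : Monotone u := by
      intro i j hij
      have := quot_mono hM hij
      simp only [hu]
      gcongr
    obtain ⟨j, hj⟩ := exists_prod_min u humono (p0 + n)
    have hf := hflat w hw hwX j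
    have hC : 0 ≤ C := by
      have := hflat w hw hwX 0
      simp [hM.1] at this
      exact (norm_nonneg _).trans this
    have hjp : ∏ i ∈ Finset.range j, u i = A ^ j * M j * Real.exp w.re ^ j := by
      simp only [hu]
      rw [Finset.prod_mul_distrib, Finset.prod_mul_distrib, seq_eq_prod hM j]
      simp [hm_def]
    calc ‖g w‖ ≤ C * (A ^ j * M j * Real.exp w.re ^ j) := by linarith
      _ = C * ∏ i ∈ Finset.range (p0 + n), min 1 (u i) := by rw [hj, hjp]
      _ ≤ C * ∏ i ∈ Finset.range n, min 1 (u (p0 + i)) := by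
        refine mul_le_mul_of_nonneg_left ?_ hC
        rw [Finset.prod_range_add]
        refine mul_le_of_le_one_left ?_ ?_
        · exact Finset.prod_nonneg fun i _ => le_min zero_le_one (hupos _).le
        · exact Finset.prod_le_one (fun i _ => le_min zero_le_one (hupos _).le)
            (fun i _ => min_le_left _ _)
  have hmain : ∀ n : ℕ, ‖g x ^ k * ∏ i ∈ Finset.range n, wfac γ (A * m (p0 + i)) x‖ ≤ L ^ k := by
    intro n
    have hbd : ∀ w : ℂ, |w.im| = h →
        ‖g w ^ k * ∏ i ∈ Finset.range n, wfac γ (A * m (p0 + i)) w‖ ≤ L ^ k := by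
      intro w hw
      rw [norm_mul, norm_pow, norm_prod]
      rcases le_or_gt w.re X with hwX | hwX
      · have h1 := hC0 w hw hwX n
        have hC : 0 ≤ C := by
          have := hflat w hw hwX 0
          simp [hM.1] at this
          exact (norm_nonneg _).trans this
        calc ‖g w‖ ^ k * ∏ i ∈ Finset.range n, ‖wfac γ (A * m (p0 + i)) w‖
            ≤ (C * ∏ i ∈ Finset.range n, min 1 (A * m (p0 + i) * Real.exp w.re)) ^ k
              * ∏ i ∈ Finset.range n, ‖wfac γ (A * m (p0 + i)) w‖ := by
              gcongr
          _ = C ^ k * ∏ i ∈ Finset.range n, ((min 1 (A * m (p0 + i) * Real.exp w.re)) ^ k *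
                ‖wfac γ (A * m (p0 + i)) w‖) := by
              rw [mul_pow, ← Finset.prod_pow, Finset.prod_mul_distrib, mul_assoc]
          _ ≤ C ^ k * 1 := by
              refine mul_le_mul_of_nonneg_left ?_ (pow_nonneg hC _)
              refine Finset.prod_le_one (fun i _ => ?_) (fun i _ => ?_)
              · have := (hvpos i).le
                positivity
              · exact min_pow_mul hγ (mul_pos (hvpos i) (Real.exp_pos _)) hk
                  (wfac_bdry hγ (hvpos i) hw)
          _ ≤ L ^ k := by
              rw [mul_one]
              exact pow_le_pow_left₀ hC (le_max_left _ _) k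
      · have h1 : ∏ i ∈ Finset.range n, ‖wfac γ (A * m (p0 + i)) w‖ ≤ 1 := by
          refine Finset.prod_le_one (fun i _ => norm_nonneg _) (fun i _ => ?_)
          refine (wfac_bdry hγ (hvpos i) hw).trans (max_le le_rfl ?_)
          refine Real.rpow_le_one_of_one_le_of_nonpos ?_ (by rw [neg_nonpos]; positivity)
          refine (hp0' i).trans ?_
          have := (hvpos i).le
          gcongr
        calc _ ≤ ‖g w‖ ^ k * 1 := by gcongr
          _ ≤ L ^ k := by
            rw [mul_one]
            exact pow_le_pow_left₀ (norm_nonneg _) ((hK w hw.le).trans (le_max_right _ _)) k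
    have hcl : closure (Complex.im ⁻¹' Ioo (-h) h) ⊆ {w : ℂ | |w.im| ≤ h} := by
      refine closure_minimal ?_ ?_
      · intro w hw
        exact abs_le.2 ⟨hw.1.le, hw.2.le⟩
      · exact isClosed_le (by fun_prop) continuous_const
    refine PhragmenLindelof.horizontal_strip (a := -h) (b := h)
      (f := fun w => g w ^ k * ∏ i ∈ Finset.range n, wfac γ (A * m (p0 + i)) w)
      ?_ ?_ ?_ ?_ (z := (x : ℂ)) ?_ ?_
    · refine ⟨?_, ?_⟩
      · refine (hd.differentiableOn.pow k).mul ?_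
        refine DifferentiableOn.fun_finsetProd fun i _ w hw => ?_
        exact (wfac_diff hγ (hvpos i) (abs_lt.2 ⟨hw.1, hw.2⟩)).differentiableWithinAt
      · refine (hd.continuousOn.pow k).mul ?_
        refine continuousOn_finsetProd _ fun i _ w hw => ?_
        exact (wfac_cont hγ (hvpos i) (hcl hw)).continuousWithinAt
    · refine ⟨1 / (2 * γ), ?_, 2 * n, ?_⟩
      · rw [hh_def, sub_neg_eq_add, show π / (γ * π / 2 + γ * π / 2) = 1 / γ by field_simp; ring]
        apply one_div_lt_one_div_of_lt hγ; linarith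
      · refine Asymptotics.IsBigO.of_bound
          (K ^ k * ∏ i ∈ Finset.range n, (1 / (A * m (p0 + i)) ^ (1 / γ) + 1)) ?_
        refine Filter.Eventually.filter_mono inf_le_right ?_
        rw [eventually_principal]
        intro w hw
        have hK0 : 0 ≤ K := (norm_nonneg _).trans (hK w (abs_le.2 ⟨hw.1.le, hw.2.le⟩))
        rw [norm_mul, norm_pow, norm_prod, mul_assoc]
        refine mul_le_mul (pow_le_pow_left₀ (norm_nonneg _)
          (hK w (abs_le.2 ⟨hw.1.le, hw.2.le⟩)) k) ?_
          (Finset.prod_nonneg fun i _ => norm_nonneg _) (pow_nonneg hK0 _)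
        calc ∏ i ∈ Finset.range n, ‖wfac γ (A * m (p0 + i)) w‖
            ≤ ∏ i ∈ Finset.range n,
              ((1 / (A * m (p0 + i)) ^ (1 / γ) + 1) * Real.exp (|w.re| / γ)) :=
              Finset.prod_le_prod (fun i _ => norm_nonneg _)
                (fun i _ => wfac_growth hγ (hvpos i) w)
          _ = (∏ i ∈ Finset.range n, (1 / (A * m (p0 + i)) ^ (1 / γ) + 1)) *
              Real.exp (n * (|w.re| / γ)) := by
              rw [Finset.prod_mul_distrib, Finset.prod_const, Finset.card_range, Real.exp_nat_mul]
          _ ≤ _ := by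
              rw [Real.norm_of_nonneg (Real.exp_pos _).le]
              refine mul_le_mul_of_nonneg_left ?_ ?_
              · apply Real.exp_le_exp.2
                have h1 := Real.add_one_le_exp (1 / (2 * γ) * |w.re|)
                have h2 : |w.re| / γ = 2 * (1 / (2 * γ) * |w.re|) := by field_simp
                rw [h2]
                have hn : (0 : ℝ) ≤ n := by positivity
                nlinarith
              · refine Finset.prod_nonneg fun i _ => ?_
                have := Real.rpow_pos_of_pos (hvpos i) (1 / γ)
                positivity
    · intro z hz
      exact hbd z (by rw [hz, abs_neg, abs_of_pos hh])
    · intro z hz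
      exact hbd z (by rw [hz, abs_of_pos hh])
    · simp [hh.le]
    · simp [hh.le]
  -- conclusion
  by_contra hgx
  have hgpos : 0 < ‖g x‖ ^ k := pow_pos (norm_pos_iff.2 hgx) k
  set c := Real.exp (-x / γ) / 2 with hc
  have hcpos : 0 < c := by positivity
  have hns2 : ¬ Summable (fun i : ℕ => c * (A * m (p0 + i)) ^ (-(1 / γ))) := by
    intro hs
    apply hns
    rw [← summable_nat_add_iff p0]
    have hA' : 0 < A ^ (-(1 / γ)) := Real.rpow_pos_of_pos hA _
    refine (hs.mul_left (c * A ^ (-(1 / γ)))⁻¹).congr fun i => ?_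
    rw [Real.mul_rpow hA.le (hmpos _).le, add_comm p0 i]
    field_simp
    rfl
  rw [not_summable_iff_tendsto_nat_atTop_of_nonneg (fun i =>
    mul_nonneg hcpos.le (Real.rpow_nonneg (hvpos i).le _))] at hns2
  obtain ⟨n, hn⟩ := (hns2.eventually_gt_atTop (L ^ k / ‖g x‖ ^ k)).exists
  have h1 := hmain n
  rw [norm_mul, norm_pow, norm_prod] at h1
  have h2 := one_add_sum_le_prod' (fun i => c * (A * m (p0 + i)) ^ (-(1 / γ)))
    (fun i => mul_nonneg hcpos.le (Real.rpow_nonneg (hvpos i).le _)) n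
  have h3 : ∏ i ∈ Finset.range n, (1 + c * (A * m (p0 + i)) ^ (-(1 / γ))) ≤
      ∏ i ∈ Finset.range n, ‖wfac γ (A * m (p0 + i)) x‖ := by
    refine Finset.prod_le_prod (fun i _ => ?_) (fun i _ => wfac_real (hvpos i) x)
    have := Real.rpow_nonneg (hvpos i).le (-(1 / γ))
    positivity
  rw [div_lt_iff₀ hgpos] at hn
  nlinarith

/-- Lemma 4.2 of the paper, Watson's lemma, two boundary directions:
suppose `γ > ω(M)`, or `γ = ω(M)` and `Σ (m_p)^{−1/ω(M)}` diverges.  If the bounded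
holomorphic `f` on `S_γ`, with continuous extension `g` to the closed sector, is `M`-flat
in both boundary directions `±πγ/2`, then `f ≡ 0`. -/
theorem watson_two_directions
    (M : ℕ → ℝ) (hM : GoodSeq M) (hPO : AdmitsNonzeroProximateOrder M)
    (γ : ℝ) (hγ0 : 0 < γ)
    (hcond : omegaM M < γ ∨ (γ = omegaM M ∧
      ¬ Summable (fun p : ℕ => (M (p + 1) / M p) ^ (-(1 / omegaM M)))))
    (f g : ℂ → ℂ)
    (hf : DifferentiableOn ℂ f (logSector 0 γ))
    (hbd : ∃ K : ℝ, ∀ w ∈ logSector 0 γ, ‖f w‖ ≤ K)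
    (hg : ContinuousOn g {w : ℂ | |w.im| ≤ γ * π / 2})
    (hfg : ∀ w ∈ logSector 0 γ, g w = f w)
    (hflat₁ : MFlatDir M g {w : ℂ | |w.im| ≤ γ * π / 2} (γ * π / 2))
    (hflat₂ : MFlatDir M g {w : ℂ | |w.im| ≤ γ * π / 2} (-(γ * π / 2))) :
    ∀ w ∈ logSector 0 γ, f w = 0 := by
  have hns : ¬ Summable (fun p : ℕ => (M (p + 1) / M p) ^ (-(1 / γ))) := by
    rcases hcond with h | ⟨h, hs⟩
    · exact not_summable_of hM hPO hγ0 h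
    · rw [h]; exact hs
  have hh : 0 < γ * π / 2 := by positivity
  have hset : logSector 0 γ = Complex.im ⁻¹' Ioo (-(γ * π / 2)) (γ * π / 2) := by
    ext w
    simp [logSector, abs_lt]
  have hopen : IsOpen (logSector 0 γ) := by
    rw [hset]; exact isOpen_Ioo.preimage Complex.continuous_im
  have hclos : closure (logSector 0 γ) = {w : ℂ | |w.im| ≤ γ * π / 2} := by
    rw [hset, Complex.closure_preimage_im, closure_Ioo (by linarith)]
    ext w
    simp [abs_le]
  have hgd : DiffContOnCl ℂ g (logSector 0 γ) := by
    refine ⟨hf.congr hfg, ?_⟩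
    rw [hclos]; exact hg
  obtain ⟨K, hK⟩ := hbd
  have hKc : ∀ w : ℂ, |w.im| ≤ γ * π / 2 → ‖g w‖ ≤ K := by
    intro w hw
    have hw' : w ∈ closure (logSector 0 γ) := by rw [hclos]; exact hw
    have hcw : ContinuousWithinAt g (logSector 0 γ) w :=
      (hg w hw).mono (by rw [← hclos]; exact subset_closure)
    have := mem_closure_iff_nhdsWithin_neBot.1 hw'
    refine le_of_tendsto hcw.norm ?_
    filter_upwards [self_mem_nhdsWithin] with z hz
    rw [hfg z hz]; exact hK z hz
  obtain ⟨r₁, C₁, A₁, hr₁, hC₁, hA₁, -, hF₁⟩ := hflat₁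
  obtain ⟨r₂, C₂, A₂, hr₂, hC₂, hA₂, -, hF₂⟩ := hflat₂
  have hflat : ∀ w : ℂ, |w.im| = γ * π / 2 → w.re ≤ min (Real.log r₁) (Real.log r₂) → ∀ p : ℕ,
      ‖g w‖ ≤ max C₁ C₂ * (max A₁ A₂) ^ p * M p * Real.exp w.re ^ p := by
    intro w hw hX p
    have hMp := (hM.2.1 p).le
    rcases (abs_eq hh.le).1 hw with h | h
    · have h1 := hF₁ w.re (hX.trans (min_le_left _ _)) p
      rw [← h, Complex.eta] at h1
      refine h1.trans ?_
      gcongr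
      · exact le_max_left _ _
      · exact le_max_left _ _
    · have h1 := hF₂ w.re (hX.trans (min_le_right _ _)) p
      rw [← h, Complex.eta] at h1
      refine h1.trans ?_
      gcongr
      · exact le_max_right _ _
      · exact le_max_right _ _
  have hreal : ∀ x : ℝ, g x = 0 :=
    watson_core hM hγ0 hns g (hset ▸ hgd) hKc (lt_max_of_lt_left hA₁) hflat
  have hmem : ∀ x : ℝ, (x : ℂ) ∈ logSector 0 γ := by
    intro x
    simpa [logSector] using hh
  have han : AnalyticOnNhd ℂ f (logSector 0 γ) := hf.analyticOnNhd hopen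
  have hpre : IsPreconnected (logSector 0 γ) := by
    rw [hset]
    exact ((convex_Ioo _ _).linear_preimage Complex.imLm).isPreconnected
  have hfreq : ∃ᶠ z in 𝓝[≠] (0 : ℂ), f z = 0 := by
    have ht : Tendsto (fun x : ℝ => (x : ℂ)) (𝓝[≠] 0) (𝓝[≠] 0) := by
      refine tendsto_nhdsWithin_iff.2 ⟨?_, ?_⟩
      · have : Tendsto (fun x : ℝ => (x : ℂ)) (𝓝 0) (𝓝 ((0 : ℝ) : ℂ)) :=
          Complex.continuous_ofReal.tendsto 0
        rw [Complex.ofReal_zero] at this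
        exact this.mono_left nhdsWithin_le_nhds
      · filter_upwards [self_mem_nhdsWithin] with x hx
        simpa using hx
    refine ht.frequently (Eventually.frequently (Eventually.of_forall fun x => ?_))
    rw [← hfg _ (hmem x)]; exact hreal x
  exact fun w hw => han.eqOn_zero_of_preconnected_of_frequently_eq_zero hpre
    (by simpa using hmem 0) hfreq hw
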